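/- Let J be a sparse symmetric shifted ideal in Z, let f ∈ G(J) with associated partition λ(f) = (λ_1 ≤ … ≤ λ_s) and f = ∏_{i : λ_i>0} z_{σ(i),λ_i} for some σ ∈ S_s, and set max(f) = max{σ(k) : λ_k = λ_s}. Let G_f be the union of the sets {z_{σ(i),j} : λ_i > 0 and 1 ≤ j < λ_i}, {z_{σ(i),j} : λ_i = 0 and 1 ≤ j < λ_s}, and {z_{σ(i),λ_s} : λ_i = 0 and σ(i) < max(f)}. Then the colon ideal (J_f : f) equals the ideal generated by the variables in G_f; in particular (J_f : f) is generated by variables. -/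

import Mathlib

open MvPolynomial

/-- The sparse squarefree monomial `z^μ = ∏_{i : μ i > 0} z_{i, μ i}`, where the variable
`z_{i,j}` (for `1 ≤ j ≤ b`) is represented by `X (i, j-1)`. -/
noncomputable def sparseMon (K : Type*) [Field K] (s b : ℕ) (μ : Fin s → ℕ) :
    MvPolynomial (Fin s × Fin b) K :=
  ∏ i : Fin s, ∏ j : Fin b, if μ i = (j : ℕ) + 1 then X (i, j) else 1

/-- `μ' ≤₀ μ`. -/
def leZero {s : ℕ} (μ' μ : Fin s → ℕ) : Prop :=
  ∀ i, μ' i ≤ μ i ∧ (μ' i = 0 ↔ μ i = 0)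

/-- The action of `σ ∈ S_s` on `Z`, sending `z_{i,j}` to `z_{σ i, j}`. -/
noncomputable def permMap (K : Type*) [Field K] (s b : ℕ) (σ : Equiv.Perm (Fin s)) :
    MvPolynomial (Fin s × Fin b) K →ₐ[K] MvPolynomial (Fin s × Fin b) K :=
  rename fun p => (σ p.1, p.2)

/-- `z^μ` is a minimal monomial generator of the monomial ideal `J`. -/
def IsMinSparseGen (K : Type*) [Field K] (s b : ℕ)
    (J : Ideal (MvPolynomial (Fin s × Fin b) K)) (μ : Fin s → ℕ) : Prop :=
  (∀ i, μ i ≤ b) ∧ sparseMon K s b μ ∈ J ∧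
    ∀ i, 0 < μ i → sparseMon K s b (Function.update μ i 0) ∉ J

/-- A proper monomial ideal `J` of `Z` is sparse symmetric shifted if (S-1) it is generated
by sparse squarefree monomials, (S-2) for every minimal monomial generator `z^μ` and every
`μ' ≤₀ μ` one has `z^{μ'} ∈ J`, and (S-3) `σ(J) = J` for every permutation `σ`. -/
def IsSSS (K : Type*) [Field K] (s b : ℕ)
    (J : Ideal (MvPolynomial (Fin s × Fin b) K)) : Prop :=
  J ≠ ⊤ ∧
  (∃ S : Set (Fin s → ℕ), (∀ μ ∈ S, ∀ i, μ i ≤ b) ∧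
      J = Ideal.span (sparseMon K s b '' S)) ∧
  (∀ μ : Fin s → ℕ, IsMinSparseGen K s b J μ →
      ∀ μ' : Fin s → ℕ, leZero μ' μ → sparseMon K s b μ' ∈ J) ∧
  (∀ σ : Equiv.Perm (Fin s), Ideal.map (permMap K s b σ) J = J)

/-- The support degree: number of nonzero entries. -/
def suppdeg {s : ℕ} (ν : Fin s → ℕ) : ℕ := (Finset.univ.filter fun i => ν i ≠ 0).card

/-- The weight: sum of the entries. -/
def wt {s : ℕ} (ν : Fin s → ℕ) : ℕ := ∑ i, ν i

/-- The associated partition: the nondecreasing rearrangement of the tuple. -/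
noncomputable def partOf {s : ℕ} (ν : Fin s → ℕ) : Fin s → ℕ := ν ∘ Tuple.sort ν

/-- Exponent vector of the sparse squarefree monomial `z^ν`. -/
def exps {s b : ℕ} (ν : Fin s → ℕ) : Fin s × Fin b → ℕ :=
  fun p => if ν p.1 = (p.2 : ℕ) + 1 then 1 else 0

/-- `z^ν >_lex z^{ν'}` for the lexicographic order on monomials induced by the variable
order `z_{i,j} > z_{i',j'}` iff `j < j'`, or `j = j'` and `i < i'`. -/
def monLexGT {s : ℕ} (b : ℕ) (ν ν' : Fin s → ℕ) : Prop :=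
  ∃ v : Fin s × Fin b, exps ν' v < exps ν v ∧
    ∀ w : Fin s × Fin b,
      ((w.2 : ℕ) < (v.2 : ℕ) ∨ ((w.2 : ℕ) = (v.2 : ℕ) ∧ (w.1 : ℕ) < (v.1 : ℕ))) →
        exps (b := b) ν w = exps ν' w

/-- The order `≺` on tuples: first compare support degrees, then weights, then the
leftmost nonzero entry of the difference must be negative. -/
def partLT {s : ℕ} (l l' : Fin s → ℕ) : Prop :=
  suppdeg l < suppdeg l' ∨
  (suppdeg l = suppdeg l' ∧ wt l < wt l') ∨
  (suppdeg l = suppdeg l' ∧ wt l = wt l' ∧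
    ∃ i : Fin s, l i < l' i ∧ ∀ j : Fin s, j < i → l j = l' j)

/-- The order `≺` on (tuples representing) minimal monomial generators:
`f₁ ≺ f₂` iff `λ(f₁) ≺ λ(f₂)`, or `λ(f₁) = λ(f₂)` and `f₁ >_lex f₂`. -/
def genPrec {s : ℕ} (b : ℕ) (ν ν' : Fin s → ℕ) : Prop :=
  partLT (partOf ν) (partOf ν') ∨ (partOf ν = partOf ν' ∧ monLexGT b ν ν')

/-- `J_f = ⟨g ∈ G(J) : g ≺ f⟩`, where `f = z^ν`. -/
noncomputable def Jf (K : Type*) [Field K] (s b : ℕ)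
    (J : Ideal (MvPolynomial (Fin s × Fin b) K)) (ν : Fin s → ℕ) :
    Ideal (MvPolynomial (Fin s × Fin b) K) :=
  Ideal.span {g | ∃ ν' : Fin s → ℕ,
    IsMinSparseGen K s b J ν' ∧ genPrec b ν' ν ∧ g = sparseMon K s b ν'}

section Tuples

variable {s b : ℕ}

theorem suppdeg_comp_perm (ν : Fin s → ℕ) (τ : Equiv.Perm (Fin s)) :
    suppdeg (ν ∘ τ) = suppdeg ν := by
  unfold suppdeg
  refine Finset.card_bij (fun i _ => τ i) ?_ ?_ ?_
  · simp
  · simp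
  · intro i hi
    exact ⟨τ.symm i, by simpa using hi, by simp⟩

theorem wt_comp_perm (ν : Fin s → ℕ) (τ : Equiv.Perm (Fin s)) : wt (ν ∘ τ) = wt ν :=
  Equiv.sum_comp τ ν

theorem suppdeg_partOf (ν : Fin s → ℕ) : suppdeg (partOf ν) = suppdeg ν :=
  suppdeg_comp_perm _ _

theorem wt_partOf (ν : Fin s → ℕ) : wt (partOf ν) = wt ν :=
  wt_comp_perm _ _

theorem partOf_comp_perm (ν : Fin s → ℕ) (τ : Equiv.Perm (Fin s)) :
    partOf (ν ∘ τ) = partOf ν :=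
  Tuple.comp_perm_comp_sort_eq_comp_sort

theorem suppdeg_mono {ν μ : Fin s → ℕ} (h : ∀ i, μ i = 0 → ν i = 0) :
    suppdeg ν ≤ suppdeg μ := by
  refine Finset.card_le_card fun i => ?_
  simpa using fun hi h' => hi (h i h')

theorem genPrec_of_suppdeg_le_of_wt_lt {ν μ : Fin s → ℕ} (hd : suppdeg ν ≤ suppdeg μ)
    (hw : wt ν < wt μ) : genPrec b ν μ := by
  left
  unfold partLT
  simp only [suppdeg_partOf, wt_partOf]
  omega

theorem suppdeg_le_of_genPrec {ν μ : Fin s → ℕ} (h : genPrec b ν μ) :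
    suppdeg ν ≤ suppdeg μ := by
  rw [← suppdeg_partOf ν, ← suppdeg_partOf μ]
  rcases h with (h | h | h) | h
  · exact h.le
  · exact h.1.le
  · exact h.1.le
  · rw [h.1]

/-- Among rearrangements of the same tuple, `≺` is the lexicographic comparison. -/
theorem monLexGT_of_genPrec_comp_perm {ν : Fin s → ℕ} {τ : Equiv.Perm (Fin s)}
    (h : genPrec b (ν ∘ τ) ν) : monLexGT b (ν ∘ τ) ν := by
  rw [genPrec, partOf_comp_perm] at h
  rcases h with (h | h | h) | h
  · exact absurd h (lt_irrefl _)
  · exact absurd h.2 (lt_irrefl _)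
  · obtain ⟨i, hi, -⟩ := h.2.2
    exact absurd hi (lt_irrefl _)
  · exact h.2

/-- Comparable tuples with no drop in weight are equal. -/
theorem eq_of_le_of_wt_le {ν μ : Fin s → ℕ} (h : ν ≤ μ) (hw : wt μ ≤ wt ν) : ν = μ := by
  funext i
  exact (Finset.sum_eq_sum_iff_of_le fun i _ => h i).1
    (le_antisymm (Finset.sum_le_sum fun i _ => h i) hw) i (Finset.mem_univ i)

/-- A finite set can be permuted into any set of at least the same size, fixing the
common elements. -/
theorem exists_perm_mapsTo_of_card_le {α : Type*} [Fintype α] [DecidableEq α] {A B : Finset α}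
    (h : A.card ≤ B.card) :
    ∃ τ : Equiv.Perm α, (∀ a ∈ A, τ a ∈ B) ∧ ∀ a ∈ A, a ∈ B → τ a = a := by
  obtain ⟨T, hT₁, hT₂, hT⟩ := Finset.exists_subsuperset_card_eq
    (Finset.inter_subset_right : A ∩ B ⊆ B) (Finset.card_le_card Finset.inter_subset_left) h
  obtain ⟨g, hg⟩ := Finset.exists_equiv_extend_of_card_eq (α := {x // x ∈ A}) (t := T)
    (by simp [hT]) (s := Finset.univ.filter fun x => (x : α) ∈ B) (f := fun x => (x : α))
    (by
      intro x hx
      simp only [Finset.mem_image, Finset.mem_filter, Finset.mem_univ, true_and] at hx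
      obtain ⟨y, hy, rfl⟩ := hx
      exact hT₁ (Finset.mem_inter.2 ⟨y.2, hy⟩))
    Subtype.val_injective.injOn
  refine ⟨Equiv.extendSubtype (p := (· ∈ A)) (q := (· ∈ T)) g, fun a ha => ?_,
    fun a ha hb => ?_⟩
  · exact hT₂ (Equiv.extendSubtype_mem (p := (· ∈ A)) (q := (· ∈ T)) g a ha)
  · rw [Equiv.extendSubtype_apply_of_mem (p := (· ∈ A)) (q := (· ∈ T)) g a ha]
    exact hg ⟨a, ha⟩ (by simpa using hb)

end Tuples

section Monomials

variable (K : Type*) [Field K] {s b : ℕ}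

theorem sparseMon_eq_monomial (ν : Fin s → ℕ) :
    sparseMon K s b ν = monomial (Finsupp.equivFunOnFinite.symm (exps ν)) 1 := by
  rw [monomial_eq, Finsupp.prod_fintype _ _ (by simp), Fintype.prod_prod_type]
  simp only [sparseMon, C_1, one_mul]
  refine Finset.prod_congr rfl fun i _ => Finset.prod_congr rfl fun j _ => ?_
  by_cases h : ν i = (j : ℕ) + 1 <;> simp [exps, h]

variable {K}

theorem sparseMon_mem_of_restrict {J : Ideal (MvPolynomial (Fin s × Fin b) K)}
    {ν μ : Fin s → ℕ} (h : ∀ i, ν i = 0 ∨ ν i = μ i) (hν : sparseMon K s b ν ∈ J) :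
    sparseMon K s b μ ∈ J := by
  refine J.mem_of_dvd ?_ hν
  refine Finset.prod_dvd_prod_of_dvd _ _ fun i _ => Finset.prod_dvd_prod_of_dvd _ _ fun j _ => ?_
  rcases h i with h | h <;> simp [h]

theorem permMap_sparseMon (σ : Equiv.Perm (Fin s)) (ν : Fin s → ℕ) :
    permMap K s b σ (sparseMon K s b ν) = sparseMon K s b (ν ∘ σ.symm) := by
  simp only [sparseMon, permMap, map_prod, Function.comp]
  refine Fintype.prod_equiv σ _ _ fun i => Finset.prod_congr rfl fun j _ => ?_
  by_cases h : ν i = (j : ℕ) + 1 <;> simp [h]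

variable {J : Ideal (MvPolynomial (Fin s × Fin b) K)}

theorem IsSSS.sparseMon_comp_perm_mem (hJ : IsSSS K s b J) {ν : Fin s → ℕ}
    (hν : sparseMon K s b ν ∈ J) (σ : Equiv.Perm (Fin s)) :
    sparseMon K s b (ν ∘ σ) ∈ J := by
  have h := Ideal.mem_map_of_mem (permMap K s b σ.symm) hν
  rw [hJ.2.2.2, permMap_sparseMon] at h
  simpa using h

theorem IsSSS.isMinSparseGen_comp_perm (hJ : IsSSS K s b J) {ν : Fin s → ℕ}
    (hν : IsMinSparseGen K s b J ν) (σ : Equiv.Perm (Fin s)) :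
    IsMinSparseGen K s b J (ν ∘ σ) := by
  refine ⟨fun i => hν.1 _, hJ.sparseMon_comp_perm_mem hν.2.1 σ, fun i hi h => ?_⟩
  refine hν.2.2 (σ i) hi ?_
  convert hJ.sparseMon_comp_perm_mem h σ.symm using 2
  funext k
  by_cases hk : k = σ i
  · simp [hk]
  · rw [Function.update_of_ne hk, Function.comp_apply, Function.update_of_ne]
    · simp
    · rwa [Ne, Equiv.symm_apply_eq]

theorem exists_isMinSparseGen_restrict {μ : Fin s → ℕ} (hb : ∀ i, μ i ≤ b)
    (hμ : sparseMon K s b μ ∈ J) :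
    ∃ ν, IsMinSparseGen K s b J ν ∧ ∀ i, ν i = 0 ∨ ν i = μ i := by
  induction h : wt μ using Nat.strong_induction_on generalizing μ with
  | _ n ih =>
    by_cases hmin : IsMinSparseGen K s b J μ
    · exact ⟨μ, hmin, fun i => Or.inr rfl⟩
    · obtain ⟨i, hi, hiJ⟩ : ∃ i, 0 < μ i ∧ sparseMon K s b (Function.update μ i 0) ∈ J := by
        by_contra! hcon
        exact hmin ⟨hb, hμ, hcon⟩
      have hle : Function.update μ i 0 ≤ μ := update_le_self_iff.2 (Nat.zero_le _)
      obtain ⟨ν, hν, hr⟩ := ih (wt (Function.update μ i 0))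
        (h ▸ Finset.sum_lt_sum (fun k _ => hle k) ⟨i, Finset.mem_univ i, by simpa using hi⟩)
        (fun k => (hle k).trans (hb k)) hiJ rfl
      refine ⟨ν, hν, fun k => ?_⟩
      rcases hr k with hk | hk
      · exact Or.inl hk
      · by_cases hki : k = i
        · subst hki
          simp [hk]
        · rw [Function.update_of_ne hki] at hk
          exact Or.inr hk

/-- A generator supported in the support of the minimal generator `z^μ`, and dominating `μ` on
its own support, has full support. -/
theorem IsSSS.le_of_forall_le (hJ : IsSSS K s b J) {μ ν : Fin s → ℕ}
    (hμ : IsMinSparseGen K s b J μ) (hν : IsMinSparseGen K s b J ν)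
    (h : ∀ i, ν i ≠ 0 → μ i ≠ 0 ∧ μ i ≤ ν i) : μ ≤ ν := by
  intro i
  by_cases hi : ν i = 0
  · by_contra! hlt
    refine hμ.2.2 i (Nat.zero_lt_of_lt hlt) (sparseMon_mem_of_restrict (ν := fun k => if ν k = 0 then 0 else μ k)
      (fun k => ?_) (hJ.2.2.1 ν hν _ fun k => ?_))
    · by_cases hk : k = i
      · simp [hk, hi]
      · rw [Function.update_of_ne hk]
        split_ifs <;> simp
    · by_cases hk : ν k = 0
      · simp [hk]
      · simpa [hk] using (h k hk).symm
  · exact (h i hi).2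

/-- If `z^ν ≺ z^μ` are minimal generators, then some variable of `z^ν` lies in `G_f`
for `f = z^μ`. -/
theorem IsSSS.exists_var_of_genPrec (hJ : IsSSS K s b J) {μ ν : Fin s → ℕ} {M : ℕ} {m : Fin s}
    (hmax : ∀ i, μ i ≤ M) (hm : ∀ i, μ i = M → i ≤ m)
    (hμ : IsMinSparseGen K s b J μ) (hν : IsMinSparseGen K s b J ν) (hlt : genPrec b ν μ) :
    ∃ i, ν i ≠ 0 ∧ ((0 < μ i ∧ ν i < μ i) ∨ (μ i = 0 ∧ ν i < M) ∨
      (μ i = 0 ∧ ν i = M ∧ i < m)) := by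
  by_contra! hcon
  obtain ⟨τ, hτ, hfix⟩ := exists_perm_mapsTo_of_card_le (suppdeg_le_of_genPrec hlt)
  simp only [Finset.mem_filter, Finset.mem_univ, true_and] at hτ hfix
  have hge : ∀ i, ν i ≠ 0 → μ i = 0 → M ≤ ν i := fun i hi h0 => (hcon i hi).2.1 h0
  have hle : μ ≤ ν ∘ τ.symm := by
    refine hJ.le_of_forall_le hμ (hJ.isMinSparseGen_comp_perm hν τ.symm) fun i hi => ?_
    have hi' := hτ _ hi
    rw [Equiv.apply_symm_apply] at hi'
    refine ⟨hi', ?_⟩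
    by_cases h0 : μ (τ.symm i) = 0
    · exact (hmax i).trans (hge _ hi h0)
    · have h1 := hfix _ hi h0
      rw [Equiv.apply_symm_apply] at h1
      have h2 := (hcon (τ.symm i) hi).1
      rw [← h1] at h2
      rw [Function.comp_apply, ← h1]
      exact h2 (Nat.pos_of_ne_zero hi')
  have hwt : wt ν ≤ wt μ := by
    by_contra! hw
    have hd : suppdeg μ ≤ suppdeg ν := by
      rw [← suppdeg_comp_perm ν τ.symm]
      exact suppdeg_mono fun i hi => Nat.le_zero.1 (hi ▸ hle i)
    rw [← suppdeg_partOf ν, ← suppdeg_partOf μ] at hd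
    rw [← wt_partOf ν, ← wt_partOf μ] at hw
    rcases hlt with (h | h | h) | h
    · omega
    · omega
    · omega
    · rw [h.1] at hw
      exact lt_irrefl _ hw
  have heq : μ = ν ∘ τ.symm := eq_of_le_of_wt_le hle (by rwa [wt_comp_perm])
  have hντ : ν = μ ∘ τ := by rw [heq, Function.comp_assoc]; simp
  obtain ⟨⟨a, j⟩, hv, hw⟩ := monLexGT_of_genPrec_comp_perm (hντ ▸ hlt : genPrec b (μ ∘ τ) μ)
  rw [← hντ] at hv hw
  have hval : ∀ i, ν i = μ (τ i) := fun i => congrFun hντ i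
  have hνa : ν a = (j : ℕ) + 1 := by
    by_contra h
    simp [exps, h] at hv
  have hμa' : μ a ≠ (j : ℕ) + 1 := by
    intro h
    simp [exps, h, hνa] at hv
  have hμa : μ a = 0 := by
    by_contra h
    have h1 := hval a
    rw [hfix a (by omega) h] at h1
    omega
  have hνM : ν a = M := le_antisymm (hval a ▸ hmax _) (hge a (by omega) hμa)
  have hma : m ≤ a := (hcon a (by omega)).2.2 hμa hνM
  obtain ⟨c, hμc, hνc⟩ : ∃ c, μ c ≠ 0 ∧ ν c = 0 := by
    by_contra! hall
    have hsub : Finset.univ.filter (fun i => μ i ≠ 0) ⊆ Finset.univ.filter fun i => ν i ≠ 0 := by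
      intro i
      simpa using hall i
    have hcard := Finset.eq_of_subset_of_card_le hsub (suppdeg_le_of_genPrec hlt)
    have : a ∈ Finset.univ.filter fun i => μ i ≠ 0 := by
      rw [hcard]
      simp [hνa]
    simp [hμa] at this
  have hcM : μ c = M := by
    have h1 : ν (τ.symm c) = μ c := by rw [heq]; rfl
    have h2 : ν (τ.symm c) ≠ 0 := by omega
    have h3 : μ (τ.symm c) = 0 := by
      by_contra h3
      have h4 := hfix _ h2 h3
      rw [Equiv.apply_symm_apply] at h4
      rw [← h4] at h2
      exact h2 hνc
    exact le_antisymm (hmax c) (h1 ▸ hge _ h2 h3)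
  have hca : c < a := lt_of_le_of_ne ((hm c hcM).trans hma) (by rintro rfl; omega)
  have := hw (c, j) (Or.inr ⟨rfl, hca⟩)
  have h1 : μ c = (j : ℕ) + 1 := by omega
  simp [exps, h1, hνc] at this

/-- For a variable `z_{a,j+1}` in `G_f` with `f = z^μ`, there is a generator `z^ν ≺ f` dividing
`z_{a,j+1} f`. -/
theorem IsSSS.exists_genPrec_of_var (hJ : IsSSS K s b J) {μ : Fin s → ℕ} {m : Fin s}
    (hμ : IsMinSparseGen K s b J μ) {a : Fin s} {j : Fin b}
    (h : (0 < μ a ∧ (j : ℕ) + 1 < μ a) ∨ (μ a = 0 ∧ (j : ℕ) + 1 < μ m) ∨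
      (μ a = 0 ∧ (j : ℕ) + 1 = μ m ∧ a < m)) :
    ∃ ν, IsMinSparseGen K s b J ν ∧ genPrec b ν μ ∧
      ∀ i, ν i = 0 ∨ ν i = μ i ∨ (i = a ∧ ν i = (j : ℕ) + 1) := by
  have key : ∀ τ : Equiv.Perm (Fin s), (j : ℕ) + 1 < μ (τ a) →
      (∀ i, i ≠ a → μ (τ i) = 0 ∨ μ (τ i) = μ i) →
      ∃ ν, IsMinSparseGen K s b J ν ∧ genPrec b ν μ ∧
        ∀ i, ν i = 0 ∨ ν i = μ i ∨ (i = a ∧ ν i = (j : ℕ) + 1) := by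
    intro τ hlt hτ
    have hle : Function.update (μ ∘ τ) a ((j : ℕ) + 1) ≤ μ ∘ τ :=
      update_le_self_iff.2 hlt.le
    have hmem : sparseMon K s b (Function.update (μ ∘ τ) a ((j : ℕ) + 1)) ∈ J := by
      refine hJ.2.2.1 _ (hJ.isMinSparseGen_comp_perm hμ τ) _ fun i => ⟨hle i, ?_⟩
      by_cases hi : i = a
      · subst hi
        simp only [Function.update_self, Function.comp]
        omega
      · rw [Function.update_of_ne hi]
    obtain ⟨ν, hν, hr⟩ := exists_isMinSparseGen_restrict
      (fun i => (hle i).trans (hμ.1 _)) hmem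
    have hνle : ∀ i, ν i ≤ μ (τ i) := fun i => by
      rcases hr i with hi | hi
      · omega
      · exact hi ▸ hle i
    refine ⟨ν, hν, genPrec_of_suppdeg_le_of_wt_lt ?_ ?_, fun i => ?_⟩
    · rw [← suppdeg_comp_perm μ τ]
      exact suppdeg_mono fun i hi => Nat.le_zero.1 (hi ▸ hνle i)
    · rw [← wt_comp_perm μ τ]
      refine Finset.sum_lt_sum (fun i _ => hνle i) ⟨a, Finset.mem_univ a, ?_⟩
      rcases hr a with ha | ha
      · simp only [Function.comp]
        omega
      · rw [ha, Function.update_self]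
        exact hlt
    · rcases hr i with hi | hi
      · exact Or.inl hi
      · by_cases hia : i = a
        · subst hia
          simp [hi]
        · rw [Function.update_of_ne hia] at hi
          rcases hτ i hia with h0 | h0
          · exact Or.inl (hi.trans h0)
          · exact Or.inr (Or.inl (hi.trans h0))
  have hswap : μ a = 0 → ∀ i, i ≠ a → μ (Equiv.swap a m i) = 0 ∨ μ (Equiv.swap a m i) = μ i := by
    intro h0 i hi
    by_cases him : i = m
    · simp [him, h0]
    · rw [Equiv.swap_apply_of_ne_of_ne hi him]
      exact Or.inr rfl
  rcases h with ⟨-, h⟩ | ⟨h0, h⟩ | ⟨h0, h, ham⟩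
  · exact key 1 h fun i _ => Or.inr rfl
  · exact key (Equiv.swap a m) (by simpa using h) (hswap h0)
  · refine ⟨μ ∘ Equiv.swap a m, hJ.isMinSparseGen_comp_perm hμ _,
      Or.inr ⟨partOf_comp_perm _ _, (a, j), ?_, ?_⟩, fun i => ?_⟩
    · simp [exps, h0, ← h]
    · rintro ⟨c, k⟩ hck
      by_cases hca : c = a
      · subst hca
        have : μ m ≠ (k : ℕ) + 1 := by simp at hck; omega
        simp [exps, h0, this]
      · by_cases hcm : c = m
        · subst hcm
          have : μ c ≠ (k : ℕ) + 1 := by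
            have : (a : ℕ) < c := ham
            simp only at hck
            omega
          simp [exps, h0, this]
        · simp [exps, Equiv.swap_apply_of_ne_of_ne hca hcm]
    · by_cases hia : i = a
      · subst hia
        simp [h]
      · rcases hswap h0 i hia with h1 | h1
        · exact Or.inl h1
        · exact Or.inr (Or.inl h1)

theorem mem_Jf_iff {μ : Fin s → ℕ} {x : MvPolynomial (Fin s × Fin b) K} :
    x ∈ Jf K s b J μ ↔ ∀ e ∈ x.support, ∃ ν, (IsMinSparseGen K s b J ν ∧ genPrec b ν μ) ∧
      Finsupp.equivFunOnFinite.symm (exps ν) ≤ e := by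
  have : Jf K s b J μ = Ideal.span ((fun e => monomial e (1 : K)) ''
      ((fun ν => Finsupp.equivFunOnFinite.symm (exps ν)) ''
        {ν | IsMinSparseGen K s b J ν ∧ genPrec b ν μ})) := by
    rw [Jf]
    congr 1
    ext g
    simp [sparseMon_eq_monomial, and_assoc, eq_comm (a := g)]
  rw [this, mem_ideal_span_monomial_image]
  simp

/-- The colon ideal `(J_f : f)` for `f = z^μ`, with `G_f` described by the tuple `μ`. -/
theorem IsSSS.colon_eq_span (hJ : IsSSS K s b J) {μ : Fin s → ℕ} {m : Fin s}
    (hmax : ∀ i, μ i ≤ μ m) (hm : ∀ i, μ i = μ m → i ≤ m) (hμ : IsMinSparseGen K s b J μ) :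
    Submodule.colon (Jf K s b J μ) (Ideal.span {sparseMon K s b μ}) =
      Ideal.span (X '' {p : Fin s × Fin b |
        (0 < μ p.1 ∧ (p.2 : ℕ) + 1 < μ p.1) ∨ (μ p.1 = 0 ∧ (p.2 : ℕ) + 1 < μ m) ∨
          (μ p.1 = 0 ∧ (p.2 : ℕ) + 1 = μ m ∧ p.1 < m)}) := by
  refine le_antisymm (fun h hh => ?_) (Ideal.span_le.2 ?_)
  · rw [Ideal.mem_colon_span_singleton, sparseMon_eq_monomial, mem_Jf_iff] at hh
    rw [mem_ideal_span_X_image]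
    intro e he
    obtain ⟨ν, ⟨hν, hlt⟩, hle⟩ := hh (e + Finsupp.equivFunOnFinite.symm (exps μ)) (by
      rw [mem_support_iff, coeff_mul_monomial, mul_one]
      exact mem_support_iff.1 he)
    obtain ⟨i, hi, hG⟩ := hJ.exists_var_of_genPrec hmax hm hμ hν hlt
    have hib := hν.1 i
    obtain ⟨j, hj⟩ : ∃ j : Fin b, ν i = (j : ℕ) + 1 := ⟨⟨ν i - 1, by omega⟩, by simp; omega⟩
    rw [hj] at hG
    refine ⟨(i, j), hG, ?_⟩
    have h1 := hle (i, j)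
    have h2 : μ i ≠ (j : ℕ) + 1 := by omega
    simp [exps, hj, h2] at h1
    exact Nat.one_le_iff_ne_zero.1 h1
  · rintro _ ⟨⟨a, j⟩, hp, rfl⟩
    obtain ⟨ν, hν, hlt, hr⟩ := hJ.exists_genPrec_of_var (a := a) (j := j) hμ hp
    rw [SetLike.mem_coe, Ideal.mem_colon_span_singleton, sparseMon_eq_monomial, mem_Jf_iff]
    intro e he
    rw [X, monomial_mul, mul_one] at he
    obtain rfl := Finset.mem_singleton.1 (support_monomial_subset he)
    refine ⟨ν, ⟨hν, hlt⟩, fun ⟨i, k⟩ => ?_⟩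
    by_cases hk : ν i = (k : ℕ) + 1
    · rcases hr i with h0 | h0 | ⟨rfl, h0⟩
      · omega
      · simp [exps, ← h0, hk]
      · have : j = k := Fin.ext (by omega)
        subst this
        simp [exps, h0]
    · simp [exps, hk]

end Monomials

/-- For a minimal generator `f = ∏_{i : λ i > 0} z_{σ i, λ i}` of a sparse
symmetric shifted ideal `J`, the colon ideal `(J_f : f)` equals the ideal generated by the
variables in `G_f`; in particular it is generated by variables. -/
theorem colon_eq_span_vars {K : Type*} [Field K] (s b : ℕ) (hs : 0 < s)
    (J : Ideal (MvPolynomial (Fin s × Fin b) K)) (hJ : IsSSS K s b J)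
    (lam : Fin s → ℕ) (hmono : Monotone lam) (hlb : ∀ i, lam i ≤ b)
    (σ : Equiv.Perm (Fin s))
    (hgen : IsMinSparseGen K s b J (lam ∘ σ.symm))
    (maxf : Fin s)
    (hm1 : ∃ k : Fin s, lam k = lam ⟨s - 1, by omega⟩ ∧ σ k = maxf)
    (hm2 : ∀ k : Fin s, lam k = lam ⟨s - 1, by omega⟩ → σ k ≤ maxf) :
    Submodule.colon (Jf K s b J (lam ∘ σ.symm))
        (Ideal.span {sparseMon K s b (lam ∘ σ.symm)}) =
      Ideal.span (X '' {p : Fin s × Fin b |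
        ∃ i : Fin s, p.1 = σ i ∧
          ((0 < lam i ∧ (p.2 : ℕ) + 1 < lam i) ∨
           (lam i = 0 ∧ (p.2 : ℕ) + 1 < lam ⟨s - 1, by omega⟩) ∨
           (lam i = 0 ∧ (p.2 : ℕ) + 1 = lam ⟨s - 1, by omega⟩ ∧ p.1 < maxf))}) := by
  have hval : ∀ i, (lam ∘ σ.symm) (σ i) = lam i := fun i => by simp
  obtain ⟨k, hk, rfl⟩ := hm1
  have hlast : ∀ i, lam i ≤ lam ⟨s - 1, by omega⟩ := fun i =>
    hmono (Fin.le_def.2 (by have := i.2; simp only; omega))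
  rw [hJ.colon_eq_span (m := σ k) (fun i => by rw [hval, hk]; exact hlast _)
    (fun i hi => by
      rw [hval, hk] at hi
      simpa using hm2 _ hi) hgen, hval]
  simp only [hk]
  congr 2
  ext p
  constructor
  · intro h
    exact ⟨σ.symm p.1, by simp, h⟩
  · rintro ⟨i, hi, h⟩
    have : (lam ∘ σ.symm) p.1 = lam i := by rw [hi, hval]
    simpa only [Set.mem_ofPred_eq, this] using h
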